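/- Let g ∈ ℤ[x] be x²-divisible of degree d with leading coefficient u_d, and let c ∈ ℚ. Then for every n ≥ 0 one has ln|g_c^n(c)| ≤ d^n ln(2|u_d| max{|c|, 4L_g}); equivalently |g_c^n(c)| ≤ (2|u_d| max{|c|, 4L_g})^{d^n}. -/

import Mathlib

open Polynomial

/-- The `n`-th iterate of `g_c := g + c` applied to `0`, for `g ∈ ℤ[x]` and `c ∈ ℚ`. -/
noncomputable def gcIter (g : ℤ[X]) (c : ℚ) (n : ℕ) : ℚ :=
  (fun x : ℚ => (g.map (Int.castRingHom ℚ)).eval x + c)^[n] 0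

/-- `g` is `x²`-divisible: degree at least 2 and zero constant and linear coefficients. -/
def IsX2Divisible (g : ℤ[X]) : Prop :=
  2 ≤ g.natDegree ∧ g.coeff 0 = 0 ∧ g.coeff 1 = 0

/-- The length `L_g = 1 + ∑_{i=2}^{d-1} |u_i|/|u_d|` of an `x²`-divisible polynomial. -/
noncomputable def Lg (g : ℤ[X]) : ℝ :=
  1 + ∑ i ∈ Finset.Ico 2 g.natDegree, (|g.coeff i| : ℝ) / (|g.leadingCoeff| : ℝ)

/-- `S_g`: the set of `c ∈ ℚ` such that the sequence `{g_c^n(0)}_{n ≥ 1}` takes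
infinitely many values. -/
def Sg (g : ℤ[X]) : Set ℚ :=
  {c : ℚ | (Set.range fun n : ℕ => gcIter g c (n + 1)).Infinite}

/-- The numerator `A_n` of `g_c^{n+1}(0) = g_c^n(c) = A_n / B_n` in lowest terms. -/
noncomputable def An (g : ℤ[X]) (c : ℚ) (n : ℕ) : ℤ := (gcIter g c (n + 1)).num

/-- The (positive) denominator `B_n` of `g_c^{n+1}(0) = g_c^n(c) = A_n / B_n`
in lowest terms. -/
noncomputable def Bn (g : ℤ[X]) (c : ℚ) (n : ℕ) : ℕ := (gcIter g c (n + 1)).den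

/-- For a natural number `a`, the factor `â = ∏_{p ∈ I(a)} p^{val_p(a)}`, where
`I(a)` consists of the primes `p` with `val_p(a) > val_p(u_d)`. -/
noncomputable def hatB (g : ℤ[X]) (a : ℕ) : ℕ :=
  ∏ p ∈ a.primeFactors.filter
      (fun p => padicValInt p g.leadingCoeff < padicValNat p a),
    p ^ padicValNat p a

/-- `g` has rapidly increasing numerators on `S`: there is an integer `N > 0` such that
for every `c ∈ S` there is a finite set `J_c ⊆ ℕ` with `#J_c ≤ N` such that for every
`n ≥ 1` outside `J_c` one has `ln |A_n| > ∑_{p ∣ n} ln |A_{n/p}|`. -/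
def RapidlyIncreasingNumerators (g : ℤ[X]) (S : Set ℚ) : Prop :=
  ∃ N : ℕ, 0 < N ∧ ∀ c ∈ S, ∃ J : Finset ℕ, J.card ≤ N ∧
    ∀ n : ℕ, 1 ≤ n → n ∉ J →
      (∑ p ∈ n.primeFactors, Real.log |(An g c (n / p) : ℝ)|) <
        Real.log |(An g c n : ℝ)|

lemma IsX2Divisible.ne_zero {g : ℤ[X]} (hg : IsX2Divisible g) : g ≠ 0 := by
  rintro rfl
  simpa using hg.1

lemma IsX2Divisible.one_le_abs_leadingCoeff {g : ℤ[X]} (hg : IsX2Divisible g) :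
    1 ≤ |(g.leadingCoeff : ℝ)| := by
  exact_mod_cast Int.one_le_abs (leadingCoeff_ne_zero.mpr hg.ne_zero)

/-- The coefficient sum below the leading term of `g`, in terms of its length. -/
lemma sum_abs_coeff_eq_mul_Lg (g : ℤ[X]) (hg : g ≠ 0) :
    ∑ i ∈ Finset.Ico 2 g.natDegree, |(g.coeff i : ℝ)| =
      |(g.leadingCoeff : ℝ)| * (Lg g - 1) := by
  have ha : |(g.leadingCoeff : ℝ)| ≠ 0 := by simpa using hg
  rw [Lg, add_sub_cancel_left, Finset.mul_sum]
  refine Finset.sum_congr rfl fun i _ => ?_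
  field_simp

lemma one_le_Lg (g : ℤ[X]) : 1 ≤ Lg g := by
  have : 0 ≤ ∑ i ∈ Finset.Ico 2 g.natDegree, (|g.coeff i| : ℝ) / (|g.leadingCoeff| : ℝ) :=
    Finset.sum_nonneg fun i _ => by positivity
  rw [Lg]
  linarith

/-- A polynomial without constant and linear term is dominated on `|x| ≤ B`, `1 ≤ B`, by its
leading term and its length. -/
lemma IsX2Divisible.abs_eval_le {g : ℤ[X]} (hg : IsX2Divisible g) {x B : ℝ} (hx : |x| ≤ B)
    (hB : 1 ≤ B) :
    |(g.map (Int.castRingHom ℝ)).eval x| ≤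
      |(g.leadingCoeff : ℝ)| * (B ^ g.natDegree + (Lg g - 1) * B ^ (g.natDegree - 1)) := by
  have hg0 := hg.ne_zero
  obtain ⟨hd, h0, h1⟩ := hg
  have hle : |(g.map (Int.castRingHom ℝ)).eval x| ≤
      ∑ i ∈ Finset.range (g.natDegree + 1), |(g.coeff i : ℝ)| * B ^ i := by
    rw [eval_map, eval₂_eq_sum_range]
    refine (Finset.abs_sum_le_sum_abs _ _).trans (Finset.sum_le_sum fun i _ => ?_)
    rw [abs_mul, abs_pow, eq_intCast]
    gcongr
  have hlow : ∑ i ∈ Finset.Ico 2 g.natDegree, |(g.coeff i : ℝ)| * B ^ i ≤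
      |(g.leadingCoeff : ℝ)| * (Lg g - 1) * B ^ (g.natDegree - 1) := by
    rw [← sum_abs_coeff_eq_mul_Lg g hg0, Finset.sum_mul]
    refine Finset.sum_le_sum fun i hi => ?_
    rw [Finset.mem_Ico] at hi
    exact mul_le_mul_of_nonneg_left (pow_le_pow_right₀ hB (by lia)) (abs_nonneg _)
  rw [Finset.sum_range_succ, ← Finset.sum_range_add_sum_Ico _ hd] at hle
  simp only [Finset.sum_range_succ, Finset.sum_range_zero, h0, h1, coeff_natDegree] at hle
  simp only [Int.cast_zero, abs_zero, zero_mul, zero_add] at hle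
  linarith

/-- The basic step: `x ↦ g x + c` maps `|x| ≤ B` into `|y| ≤ 2 |u_d| B ^ d`. -/
lemma IsX2Divisible.abs_eval_add_le {g : ℤ[X]} (hg : IsX2Divisible g) {x c B : ℝ}
    (hx : |x| ≤ B) (hB : max |c| (4 * Lg g) ≤ B) :
    |(g.map (Int.castRingHom ℝ)).eval x + c| ≤
      2 * |(g.leadingCoeff : ℝ)| * B ^ g.natDegree := by
  have hL := one_le_Lg g
  obtain ⟨hc, hLB⟩ := max_le_iff.mp hB
  have heval := hg.abs_eval_le hx (by linarith)
  have hd := hg.1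
  have ha := hg.one_le_abs_leadingCoeff
  have hpow : B ^ g.natDegree = B * B ^ (g.natDegree - 1) := by
    rw [← pow_succ']
    congr 1
    lia
  have hBP : B ≤ B ^ (g.natDegree - 1) := le_self_pow₀ (by linarith) (by lia)
  set P := B ^ (g.natDegree - 1)
  set a := |(g.leadingCoeff : ℝ)|
  rw [hpow] at heval ⊢
  have hlen : (Lg g - 1) * P ≤ B / 4 * P :=
    mul_le_mul_of_nonneg_right (by linarith) (by linarith)
  have hlen' : a * (B * P + (Lg g - 1) * P) ≤ a * (B * P + B / 4 * P) := by gcongr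
  have hBBP : 4 * B ≤ B * P := by nlinarith
  have haBP : B * P ≤ a * (B * P) := le_mul_of_one_le_left (by linarith) ha
  have := abs_add_le ((g.map (Int.castRingHom ℝ)).eval x) c
  nlinarith

lemma gcIter_succ (g : ℤ[X]) (c : ℚ) (n : ℕ) :
    gcIter g c (n + 1) = (g.map (Int.castRingHom ℚ)).eval (gcIter g c n) + c := by
  rw [gcIter, Function.iterate_succ_apply']
  rfl

lemma gcIter_succ_cast (g : ℤ[X]) (c : ℚ) (n : ℕ) :
    (gcIter g c (n + 1) : ℝ) =
      (g.map (Int.castRingHom ℝ)).eval (gcIter g c n : ℝ) + c := by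
  rw [gcIter_succ, Rat.cast_add, eval_map, eval_map, eval₂_eq_sum_range, eval₂_eq_sum_range]
  push_cast
  simp

/-- The bound on iterates, sharpened by a factor `2 |u_d|` so that it is inductive. -/
lemma IsX2Divisible.two_mul_leadingCoeff_mul_abs_gcIter_le {g : ℤ[X]} (hg : IsX2Divisible g)
    (c : ℚ) (n : ℕ) :
    2 * |(g.leadingCoeff : ℝ)| * |(gcIter g c (n + 1) : ℝ)| ≤
      (2 * |(g.leadingCoeff : ℝ)| * max |(c : ℝ)| (4 * Lg g)) ^ (g.natDegree ^ n) := by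
  have ha := hg.one_le_abs_leadingCoeff
  have hL := one_le_Lg g
  have hM : 4 * Lg g ≤ max |(c : ℝ)| (4 * Lg g) := le_max_right _ _
  have hcM : |(c : ℝ)| ≤ max |(c : ℝ)| (4 * Lg g) := le_max_left _ _
  have hd := hg.1
  induction n with
  | zero =>
    have h : gcIter g c 1 = c := by
      rw [gcIter_succ]
      simp [gcIter, ← coeff_zero_eq_eval_zero, hg.2.1]
    rw [zero_add, h, pow_zero, pow_one]
    gcongr
  | succ n ih =>
    set M := max |(c : ℝ)| (4 * Lg g) with hMdef
    set a := |(g.leadingCoeff : ℝ)|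
    set R := (2 * a * M) ^ (g.natDegree ^ n) with hR
    have hMR : 2 * a * M ≤ R := le_self_pow₀ (by nlinarith) (pow_ne_zero _ (by lia))
    have hstep := hg.abs_eval_add_le (x := gcIter g c (n + 1)) (c := c) (B := R / (2 * a))
      (by rw [le_div_iff₀ (by positivity)]; linarith)
      (by rw [← hMdef, le_div_iff₀ (by positivity)]; linarith)
    rw [gcIter_succ_cast, pow_succ, pow_mul, ← hR]
    have hR0 : 0 ≤ R := by nlinarith
    calc _ ≤ 2 * a * (2 * a * (R / (2 * a)) ^ g.natDegree) := by gcongr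
      _ = (2 * a) ^ 2 * (R / (2 * a)) ^ g.natDegree := by ring
      _ ≤ (2 * a) ^ g.natDegree * (R / (2 * a)) ^ g.natDegree := by
        gcongr
        linarith
      _ = R ^ g.natDegree := by
        rw [← mul_pow, mul_div_cancel₀ _ (by positivity)]

/-- Lemma 2.8(2): `|g_c^n(c)| ≤ (2|u_d| max{|c|, 4L_g})^{d^n}`; equivalently
`ln |g_c^n(c)| ≤ d^n · ln (2 |u_d| max{|c|, 4 L_g})`. -/
theorem iterate_abs_upper_bound (g : ℤ[X]) (hg : IsX2Divisible g) (c : ℚ) (n : ℕ) :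
    |(gcIter g c (n + 1) : ℝ)| ≤
      (2 * |(g.leadingCoeff : ℝ)| * max |(c : ℝ)| (4 * Lg g)) ^ (g.natDegree ^ n) ∧
    Real.log |(gcIter g c (n + 1) : ℝ)| ≤
      (g.natDegree : ℝ) ^ n *
        Real.log (2 * |(g.leadingCoeff : ℝ)| * max |(c : ℝ)| (4 * Lg g)) := by
  have hL := one_le_Lg g
  have hM : 4 * Lg g ≤ max |(c : ℝ)| (4 * Lg g) := le_max_right _ _
  have ha := hg.one_le_abs_leadingCoeff
  have hbound : |(gcIter g c (n + 1) : ℝ)| ≤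
      (2 * |(g.leadingCoeff : ℝ)| * max |(c : ℝ)| (4 * Lg g)) ^ (g.natDegree ^ n) :=
    (le_mul_of_one_le_left (abs_nonneg _) (by linarith)).trans
      (hg.two_mul_leadingCoeff_mul_abs_gcIter_le c n)
  refine ⟨hbound, ?_⟩
  rcases (abs_nonneg (gcIter g c (n + 1) : ℝ)).eq_or_lt with h | h
  · rw [← h, Real.log_zero]
    exact mul_nonneg (by positivity) (Real.log_nonneg (by nlinarith))
  · simpa [Real.log_pow] using Real.log_le_log h hbound
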